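/- If (φ_ε)_{ε∈(0,1]} ∈ M_Φ(Ω×ℝ^p), then the net (e^{iφ_ε})_ε is a moderate net in S^0_{0,1}(Ω×(ℝ^p∖0)): for every compact K ⊆ Ω×(ℝ^p∖0) and all multi-indices α, β there exists N ∈ ℕ with sup_{(y,ξ)∈K^c} ⟨ξ⟩^{−|β|} |∂^α_ξ ∂^β_y e^{iφ_ε(y,ξ)}| = O(ε^{−N}) as ε→0, where K^c := {(y,tξ) : (y,ξ) ∈ K, t ≥ 1}. -/

import Mathlib

open MeasureTheory Set
open scoped BigOperators Topology Real

noncomputable section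

/-- `Euc d` is `d`-dimensional Euclidean space. -/
abbrev Euc (d : ℕ) : Type := EuclideanSpace ℝ (Fin d)

/-- Directional derivative of `f` in direction `v`. -/
def dirD {E F : Type*} [NormedAddCommGroup E] [NormedSpace ℝ E]
    [NormedAddCommGroup F] [NormedSpace ℝ F] (v : E) (f : E → F) : E → F :=
  fun x => fderiv ℝ f x v

/-- Iterated directional derivatives along a list of directions. -/
def dirDs {E F : Type*} [NormedAddCommGroup E] [NormedSpace ℝ E]
    [NormedAddCommGroup F] [NormedSpace ℝ F] (L : List E) (f : E → F) : E → F :=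
  L.foldr dirD f

/-- ⟨ξ⟩ = (1+|ξ|²)^{1/2}. -/
def jb {d : ℕ} (ξ : Euc d) : ℝ := Real.sqrt (1 + ‖ξ‖ ^ 2)

/-- Basis direction in the first (`y`) block. -/
def eY {n p : ℕ} (k : Fin n) : Euc n × Euc p := (EuclideanSpace.single k 1, 0)

/-- Basis direction in the second (`ξ`) block. -/
def eXi {n p : ℕ} (j : Fin p) : Euc n × Euc p := (0, EuclideanSpace.single j 1)

def eX3 {q n p : ℕ} (i : Fin q) : Euc q × Euc n × Euc p := (EuclideanSpace.single i 1, 0, 0)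
def eY3 {q n p : ℕ} (k : Fin n) : Euc q × Euc n × Euc p := (0, EuclideanSpace.single k 1, 0)
def eXi3 {q n p : ℕ} (j : Fin p) : Euc q × Euc n × Euc p := (0, 0, EuclideanSpace.single j 1)

/-- basis directions of `Euc d` indexed by a list of coordinates -/
def basisL {d : ℕ} (L : List (Fin d)) : List (Euc d) :=
  L.map (fun i => EuclideanSpace.single i 1)

/-- |∇_{y,ξ}φ|² as a sum of squares of partial derivatives. -/
def gradSq {n p : ℕ} (φ : Euc n × Euc p → ℝ) (z : Euc n × Euc p) : ℝ :=
  (∑ k : Fin n, (dirD (eY k) φ z) ^ 2) + ∑ j : Fin p, (dirD (eXi j) φ z) ^ 2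

/-- |∇_ξ φ|². -/
def gradXiSq {n p : ℕ} (φ : Euc n × Euc p → ℝ) (z : Euc n × Euc p) : ℝ :=
  ∑ j : Fin p, (dirD (eXi j) φ z) ^ 2

/-- ∇_y φ as a vector in `Euc n`. -/
def gradY {n p : ℕ} (φ : Euc n × Euc p → ℝ) (z : Euc n × Euc p) : Euc n :=
  (EuclideanSpace.equiv (Fin n) ℝ).symm (fun k => dirD (eY k) φ z)

/-- |∇_{y,ξ}φ|² in the three-block setting (gradient w.r.t. `(y,ξ)` only). -/
def gradSq3 {q n p : ℕ} (φ : Euc q × Euc n × Euc p → ℝ) (z : Euc q × Euc n × Euc p) : ℝ :=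
  (∑ k : Fin n, (dirD (eY3 k) φ z) ^ 2) + ∑ j : Fin p, (dirD (eXi3 j) φ z) ^ 2

/-- slow scale net -/
def SlowScale (s : ℝ → ℝ) : Prop :=
  (∀ ε ∈ Set.Ioc (0:ℝ) 1, 0 < s ε) ∧
  ∀ q : ℕ, ∃ c > 0, ∀ ε ∈ Set.Ioc (0:ℝ) 1, s ε ^ q ≤ c / ε

/-- Moderate net in S^m_{ρ,δ}(Ω×ℝ^p): smoothness, membership, moderate bounds. -/
def SymbModerate {n p : ℕ} (Ω : Set (Euc n)) (m ρ δ : ℝ)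
    (a : ℝ → Euc n × Euc p → ℂ) : Prop :=
  (∀ ε ∈ Set.Ioc (0:ℝ) 1, ContDiffOn ℝ (⊤ : ℕ∞) (a ε) (Ω ×ˢ (univ : Set (Euc p)))) ∧
  (∀ ε ∈ Set.Ioc (0:ℝ) 1, ∀ K ⊆ Ω, IsCompact K → ∀ (α : List (Fin p)) (β : List (Fin n)),
    ∃ C : ℝ, ∀ y ∈ K, ∀ ξ : Euc p,
      jb ξ ^ (-m + ρ * (α.length : ℝ) - δ * (β.length : ℝ)) *
        ‖dirDs (α.map eXi ++ β.map eY) (a ε) (y, ξ)‖ ≤ C) ∧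
  ∀ K ⊆ Ω, IsCompact K → ∀ (α : List (Fin p)) (β : List (Fin n)),
    ∃ N : ℕ, ∃ C > 0, ∃ η ∈ Set.Ioc (0:ℝ) 1, ∀ ε ∈ Set.Ioc (0:ℝ) η, ∀ y ∈ K, ∀ ξ : Euc p,
      jb ξ ^ (-m + ρ * (α.length : ℝ) - δ * (β.length : ℝ)) *
        ‖dirDs (α.map eXi ++ β.map eY) (a ε) (y, ξ)‖ ≤ C * ε ^ (-(N : ℤ))

/-- Negligible net in S^m_{ρ,δ}(Ω×ℝ^p). -/
def SymbNegligible {n p : ℕ} (Ω : Set (Euc n)) (m ρ δ : ℝ)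
    (a : ℝ → Euc n × Euc p → ℂ) : Prop :=
  (∀ ε ∈ Set.Ioc (0:ℝ) 1, ContDiffOn ℝ (⊤ : ℕ∞) (a ε) (Ω ×ˢ (univ : Set (Euc p)))) ∧
  (∀ ε ∈ Set.Ioc (0:ℝ) 1, ∀ K ⊆ Ω, IsCompact K → ∀ (α : List (Fin p)) (β : List (Fin n)),
    ∃ C : ℝ, ∀ y ∈ K, ∀ ξ : Euc p,
      jb ξ ^ (-m + ρ * (α.length : ℝ) - δ * (β.length : ℝ)) *
        ‖dirDs (α.map eXi ++ β.map eY) (a ε) (y, ξ)‖ ≤ C) ∧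
  ∀ K ⊆ Ω, IsCompact K → ∀ (α : List (Fin p)) (β : List (Fin n)), ∀ q : ℕ,
    ∃ C > 0, ∃ η ∈ Set.Ioc (0:ℝ) 1, ∀ ε ∈ Set.Ioc (0:ℝ) η, ∀ y ∈ K, ∀ ξ : Euc p,
      jb ξ ^ (-m + ρ * (α.length : ℝ) - δ * (β.length : ℝ)) *
        ‖dirDs (α.map eXi ++ β.map eY) (a ε) (y, ξ)‖ ≤ C * ε ^ q

/-- Regular net in S^m_{ρ,δ}(Ω×ℝ^p): one N works for all derivatives on each compact set. -/
def SymbRegular {n p : ℕ} (Ω : Set (Euc n)) (m ρ δ : ℝ)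
    (a : ℝ → Euc n × Euc p → ℂ) : Prop :=
  (∀ ε ∈ Set.Ioc (0:ℝ) 1, ContDiffOn ℝ (⊤ : ℕ∞) (a ε) (Ω ×ˢ (univ : Set (Euc p)))) ∧
  (∀ ε ∈ Set.Ioc (0:ℝ) 1, ∀ K ⊆ Ω, IsCompact K → ∀ (α : List (Fin p)) (β : List (Fin n)),
    ∃ C : ℝ, ∀ y ∈ K, ∀ ξ : Euc p,
      jb ξ ^ (-m + ρ * (α.length : ℝ) - δ * (β.length : ℝ)) *
        ‖dirDs (α.map eXi ++ β.map eY) (a ε) (y, ξ)‖ ≤ C) ∧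
  ∀ K ⊆ Ω, IsCompact K → ∃ N : ℕ, ∀ (α : List (Fin p)) (β : List (Fin n)),
    ∃ C > 0, ∃ η ∈ Set.Ioc (0:ℝ) 1, ∀ ε ∈ Set.Ioc (0:ℝ) η, ∀ y ∈ K, ∀ ξ : Euc p,
      jb ξ ^ (-m + ρ * (α.length : ℝ) - δ * (β.length : ℝ)) *
        ‖dirDs (α.map eXi ++ β.map eY) (a ε) (y, ξ)‖ ≤ C * ε ^ (-(N : ℤ))

/-- Moderate net in S^m_hg(Ω×ℝ^p∖0) (F-valued, positively homogeneous symbols). -/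
def HgModerate {n p : ℕ} {F : Type*} [NormedAddCommGroup F] [NormedSpace ℝ F]
    (Ω : Set (Euc n)) (m : ℝ) (φ : ℝ → Euc n × Euc p → F) : Prop :=
  ∀ K ⊆ Ω, IsCompact K → ∀ (α : List (Fin p)) (β : List (Fin n)),
    ∃ N : ℕ, ∃ C > 0, ∃ η ∈ Set.Ioc (0:ℝ) 1, ∀ ε ∈ Set.Ioc (0:ℝ) η, ∀ y ∈ K,
      ∀ ξ : Euc p, ξ ≠ 0 →
      ‖ξ‖ ^ (-m + (α.length : ℝ)) *
        ‖dirDs (α.map eXi ++ β.map eY) (φ ε) (y, ξ)‖ ≤ C * ε ^ (-(N : ℤ))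

/-- Negligible net in S^m_hg(Ω×ℝ^p∖0). -/
def HgNegligible {n p : ℕ} {F : Type*} [NormedAddCommGroup F] [NormedSpace ℝ F]
    (Ω : Set (Euc n)) (m : ℝ) (φ : ℝ → Euc n × Euc p → F) : Prop :=
  ∀ K ⊆ Ω, IsCompact K → ∀ (α : List (Fin p)) (β : List (Fin n)), ∀ q : ℕ,
    ∃ C > 0, ∃ η ∈ Set.Ioc (0:ℝ) 1, ∀ ε ∈ Set.Ioc (0:ℝ) η, ∀ y ∈ K,
      ∀ ξ : Euc p, ξ ≠ 0 →
      ‖ξ‖ ^ (-m + (α.length : ℝ)) *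
        ‖dirDs (α.map eXi ++ β.map eY) (φ ε) (y, ξ)‖ ≤ C * ε ^ q

/-- Net of phase functions on Ω×ℝ^p. -/
def IsPhaseNet {n p : ℕ} (Ω : Set (Euc n)) (φ : ℝ → Euc n × Euc p → ℝ) : Prop :=
  ∀ ε ∈ Set.Ioc (0:ℝ) 1,
    ContDiffOn ℝ (⊤ : ℕ∞) (φ ε) (Ω ×ˢ {ξ : Euc p | ξ ≠ 0}) ∧
    (∀ y ∈ Ω, ∀ ξ : Euc p, ξ ≠ 0 → ∀ t : ℝ, 0 < t → φ ε (y, t • ξ) = t * φ ε (y, ξ)) ∧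
    (∀ y ∈ Ω, ∀ ξ : Euc p, ξ ≠ 0 → gradSq (φ ε) (y, ξ) ≠ 0)

/-- The set M_Φ(Ω×ℝ^p) of moderate nets of phase functions with strictly nonzero gradient. -/
def MPhi {n p : ℕ} (Ω : Set (Euc n)) (φ : ℝ → Euc n × Euc p → ℝ) : Prop :=
  IsPhaseNet Ω φ ∧ HgModerate Ω 1 φ ∧
  ∀ K ⊆ Ω, IsCompact K → ∃ r > (0:ℝ), ∃ η ∈ Set.Ioc (0:ℝ) 1, ∀ ε ∈ Set.Ioc (0:ℝ) η,
    ∀ y ∈ K, ∀ ξ : Euc p, ξ ≠ 0 → ε ^ r ≤ gradSq (φ ε) (y, ‖ξ‖⁻¹ • ξ)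

/-- Slow scale moderateness in S^m_hg. -/
def HgSlowScale {n p : ℕ} {F : Type*} [NormedAddCommGroup F] [NormedSpace ℝ F]
    (Ω : Set (Euc n)) (m : ℝ) (φ : ℝ → Euc n × Euc p → F) : Prop :=
  ∀ K ⊆ Ω, IsCompact K → ∀ (α : List (Fin p)) (β : List (Fin n)),
    ∃ s : ℝ → ℝ, SlowScale s ∧ ∃ η ∈ Set.Ioc (0:ℝ) 1, ∀ ε ∈ Set.Ioc (0:ℝ) η, ∀ y ∈ K,
      ∀ ξ : Euc p, ξ ≠ 0 →
      ‖ξ‖ ^ (-m + (α.length : ℝ)) *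
        ‖dirDs (α.map eXi ++ β.map eY) (φ ε) (y, ξ)‖ ≤ s ε

/-- Slow scale nets of phase functions M_{Φ,sc}(Ω×ℝ^p). -/
def MPhiSc {n p : ℕ} (Ω : Set (Euc n)) (φ : ℝ → Euc n × Euc p → ℝ) : Prop :=
  IsPhaseNet Ω φ ∧ HgSlowScale Ω 1 φ ∧
  ∀ K ⊆ Ω, IsCompact K → ∃ s : ℝ → ℝ, SlowScale s ∧ ∃ η ∈ Set.Ioc (0:ℝ) 1,
    ∀ ε ∈ Set.Ioc (0:ℝ) η, ∀ y ∈ K, ∀ ξ : Euc p, ξ ≠ 0 →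
      (s ε)⁻¹ ≤ gradSq (φ ε) (y, ‖ξ‖⁻¹ • ξ)

/-- cut-off function equal to 1 for |ξ|<1/4 and 0 for |ξ|>1/2. -/
def IsCutoff {p : ℕ} (χ : Euc p → ℝ) : Prop :=
  ContDiff ℝ (⊤ : ℕ∞) χ ∧ (∀ ξ : Euc p, ‖ξ‖ < 1/4 → χ ξ = 1) ∧ (∀ ξ : Euc p, 1/2 < ‖ξ‖ → χ ξ = 0)

/-- 1/|∇_{y,ξ}φ(y,ξ/|ξ|)|². -/
def varphiN {n p : ℕ} (φ : Euc n × Euc p → ℝ) (z : Euc n × Euc p) : ℝ :=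
  (gradSq φ (z.1, ‖z.2‖⁻¹ • z.2))⁻¹

def coefA {n p : ℕ} (χ : Euc p → ℝ) (φ : Euc n × Euc p → ℝ) (j : Fin p) :
    Euc n × Euc p → ℂ :=
  fun z => Complex.I * (((1 - χ z.2) * varphiN φ z * dirD (eXi j) φ z : ℝ) : ℂ)

def coefB {n p : ℕ} (χ : Euc p → ℝ) (φ : Euc n × Euc p → ℝ) (k : Fin n) :
    Euc n × Euc p → ℂ :=
  fun z => Complex.I * (((1 - χ z.2) * (‖z.2‖ ^ 2)⁻¹ * varphiN φ z * dirD (eY k) φ z : ℝ) : ℂ)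

def coefC {n p : ℕ} (χ : Euc p → ℝ) (φ : Euc n × Euc p → ℝ) : Euc n × Euc p → ℂ :=
  fun z => ((χ z.2 : ℝ) : ℂ) + (∑ j : Fin p, dirD (eXi j) (coefA χ φ j) z)
    + ∑ k : Fin n, dirD (eY k) (coefB χ φ k) z

/-- The operator L_φ. -/
def Lop {n p : ℕ} (χ : Euc p → ℝ) (φ : Euc n × Euc p → ℝ) (f : Euc n × Euc p → ℂ) :
    Euc n × Euc p → ℂ :=
  fun z => (∑ j : Fin p, coefA χ φ j z * dirD (eXi j) f z)
    + (∑ k : Fin n, coefB χ φ k z * dirD (eY k) f z) + coefC χ φ z * f z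

/-- Moderate nets of smooth functions E_M(Ω). -/
def EMod {d : ℕ} (Ω : Set (Euc d)) (v : ℝ → Euc d → ℂ) : Prop :=
  (∀ ε ∈ Set.Ioc (0:ℝ) 1, ContDiffOn ℝ (⊤ : ℕ∞) (v ε) Ω) ∧
  ∀ K ⊆ Ω, IsCompact K → ∀ L : List (Fin d),
    ∃ N : ℕ, ∃ C > 0, ∃ η ∈ Set.Ioc (0:ℝ) 1, ∀ ε ∈ Set.Ioc (0:ℝ) η, ∀ x ∈ K,
      ‖dirDs (basisL L) (v ε) x‖ ≤ C * ε ^ (-(N : ℤ))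

/-- Regular nets of smooth functions E^∞_M(Ω). -/
def EModInf {d : ℕ} (Ω : Set (Euc d)) (v : ℝ → Euc d → ℂ) : Prop :=
  (∀ ε ∈ Set.Ioc (0:ℝ) 1, ContDiffOn ℝ (⊤ : ℕ∞) (v ε) Ω) ∧
  ∀ K ⊆ Ω, IsCompact K → ∃ N : ℕ, ∀ L : List (Fin d),
    ∃ C > 0, ∃ η ∈ Set.Ioc (0:ℝ) 1, ∀ ε ∈ Set.Ioc (0:ℝ) η, ∀ x ∈ K,
      ‖dirDs (basisL L) (v ε) x‖ ≤ C * ε ^ (-(N : ℤ))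

/-- Moderate net in S^m_{ρ,δ}(Ω'×Ω×ℝ^p). -/
def Symb3Moderate {q n p : ℕ} (Ω' : Set (Euc q)) (Ω : Set (Euc n)) (m ρ δ : ℝ)
    (a : ℝ → Euc q × Euc n × Euc p → ℂ) : Prop :=
  (∀ ε ∈ Set.Ioc (0:ℝ) 1, ContDiffOn ℝ (⊤ : ℕ∞) (a ε) (Ω' ×ˢ Ω ×ˢ (univ : Set (Euc p)))) ∧
  (∀ ε ∈ Set.Ioc (0:ℝ) 1, ∀ K' ⊆ Ω', IsCompact K' → ∀ K ⊆ Ω, IsCompact K →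
    ∀ (α : List (Fin p)) (βx : List (Fin q)) (βy : List (Fin n)),
    ∃ C : ℝ, ∀ x ∈ K', ∀ y ∈ K, ∀ ξ : Euc p,
      jb ξ ^ (-m + ρ * (α.length : ℝ) - δ * ((βx.length + βy.length : ℕ) : ℝ)) *
        ‖dirDs (α.map eXi3 ++ βx.map eX3 ++ βy.map eY3) (a ε) (x, y, ξ)‖ ≤ C) ∧
  ∀ K' ⊆ Ω', IsCompact K' → ∀ K ⊆ Ω, IsCompact K →
    ∀ (α : List (Fin p)) (βx : List (Fin q)) (βy : List (Fin n)),
    ∃ N : ℕ, ∃ C > 0, ∃ η ∈ Set.Ioc (0:ℝ) 1, ∀ ε ∈ Set.Ioc (0:ℝ) η,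
      ∀ x ∈ K', ∀ y ∈ K, ∀ ξ : Euc p,
      jb ξ ^ (-m + ρ * (α.length : ℝ) - δ * ((βx.length + βy.length : ℕ) : ℝ)) *
        ‖dirDs (α.map eXi3 ++ βx.map eX3 ++ βy.map eY3) (a ε) (x, y, ξ)‖ ≤ C * ε ^ (-(N : ℤ))

/-- Regular net in S^m_{ρ,δ}(Ω'×Ω×ℝ^p). -/
def Symb3Regular {q n p : ℕ} (Ω' : Set (Euc q)) (Ω : Set (Euc n)) (m ρ δ : ℝ)
    (a : ℝ → Euc q × Euc n × Euc p → ℂ) : Prop :=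
  (∀ ε ∈ Set.Ioc (0:ℝ) 1, ContDiffOn ℝ (⊤ : ℕ∞) (a ε) (Ω' ×ˢ Ω ×ˢ (univ : Set (Euc p)))) ∧
  (∀ ε ∈ Set.Ioc (0:ℝ) 1, ∀ K' ⊆ Ω', IsCompact K' → ∀ K ⊆ Ω, IsCompact K →
    ∀ (α : List (Fin p)) (βx : List (Fin q)) (βy : List (Fin n)),
    ∃ C : ℝ, ∀ x ∈ K', ∀ y ∈ K, ∀ ξ : Euc p,
      jb ξ ^ (-m + ρ * (α.length : ℝ) - δ * ((βx.length + βy.length : ℕ) : ℝ)) *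
        ‖dirDs (α.map eXi3 ++ βx.map eX3 ++ βy.map eY3) (a ε) (x, y, ξ)‖ ≤ C) ∧
  ∀ K' ⊆ Ω', IsCompact K' → ∀ K ⊆ Ω, IsCompact K → ∃ N : ℕ,
    ∀ (α : List (Fin p)) (βx : List (Fin q)) (βy : List (Fin n)),
    ∃ C > 0, ∃ η ∈ Set.Ioc (0:ℝ) 1, ∀ ε ∈ Set.Ioc (0:ℝ) η,
      ∀ x ∈ K', ∀ y ∈ K, ∀ ξ : Euc p,
      jb ξ ^ (-m + ρ * (α.length : ℝ) - δ * ((βx.length + βy.length : ℕ) : ℝ)) *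
        ‖dirDs (α.map eXi3 ++ βx.map eX3 ++ βy.map eY3) (a ε) (x, y, ξ)‖ ≤ C * ε ^ (-(N : ℤ))

/-- Moderate net of order −∞ on Ω'×Ω×ℝ^p. -/
def Smoothing3Moderate {q n p : ℕ} (Ω' : Set (Euc q)) (Ω : Set (Euc n))
    (a : ℝ → Euc q × Euc n × Euc p → ℂ) : Prop :=
  (∀ ε ∈ Set.Ioc (0:ℝ) 1, ContDiffOn ℝ (⊤ : ℕ∞) (a ε) (Ω' ×ˢ Ω ×ˢ (univ : Set (Euc p)))) ∧
  (∀ ε ∈ Set.Ioc (0:ℝ) 1, ∀ m : ℝ, ∀ K' ⊆ Ω', IsCompact K' → ∀ K ⊆ Ω, IsCompact K →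
    ∀ (α : List (Fin p)) (βx : List (Fin q)) (βy : List (Fin n)),
    ∃ C : ℝ, ∀ x ∈ K', ∀ y ∈ K, ∀ ξ : Euc p,
      jb ξ ^ (-m + (α.length : ℝ)) *
        ‖dirDs (α.map eXi3 ++ βx.map eX3 ++ βy.map eY3) (a ε) (x, y, ξ)‖ ≤ C) ∧
  ∀ m : ℝ, ∀ K' ⊆ Ω', IsCompact K' → ∀ K ⊆ Ω, IsCompact K →
    ∀ (α : List (Fin p)) (βx : List (Fin q)) (βy : List (Fin n)),
    ∃ N : ℕ, ∃ C > 0, ∃ η ∈ Set.Ioc (0:ℝ) 1, ∀ ε ∈ Set.Ioc (0:ℝ) η,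
      ∀ x ∈ K', ∀ y ∈ K, ∀ ξ : Euc p,
      jb ξ ^ (-m + (α.length : ℝ)) *
        ‖dirDs (α.map eXi3 ++ βx.map eX3 ++ βy.map eY3) (a ε) (x, y, ξ)‖ ≤ C * ε ^ (-(N : ℤ))

/-- Regular net of order −∞ on Ω'×Ω×ℝ^p. -/
def Smoothing3Regular {q n p : ℕ} (Ω' : Set (Euc q)) (Ω : Set (Euc n))
    (a : ℝ → Euc q × Euc n × Euc p → ℂ) : Prop :=
  (∀ ε ∈ Set.Ioc (0:ℝ) 1, ContDiffOn ℝ (⊤ : ℕ∞) (a ε) (Ω' ×ˢ Ω ×ˢ (univ : Set (Euc p)))) ∧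
  (∀ ε ∈ Set.Ioc (0:ℝ) 1, ∀ m : ℝ, ∀ K' ⊆ Ω', IsCompact K' → ∀ K ⊆ Ω, IsCompact K →
    ∀ (α : List (Fin p)) (βx : List (Fin q)) (βy : List (Fin n)),
    ∃ C : ℝ, ∀ x ∈ K', ∀ y ∈ K, ∀ ξ : Euc p,
      jb ξ ^ (-m + (α.length : ℝ)) *
        ‖dirDs (α.map eXi3 ++ βx.map eX3 ++ βy.map eY3) (a ε) (x, y, ξ)‖ ≤ C) ∧
  ∀ K' ⊆ Ω', IsCompact K' → ∀ K ⊆ Ω, IsCompact K → ∃ N : ℕ, ∀ m : ℝ,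
    ∀ (α : List (Fin p)) (βx : List (Fin q)) (βy : List (Fin n)),
    ∃ C > 0, ∃ η ∈ Set.Ioc (0:ℝ) 1, ∀ ε ∈ Set.Ioc (0:ℝ) η,
      ∀ x ∈ K', ∀ y ∈ K, ∀ ξ : Euc p,
      jb ξ ^ (-m + (α.length : ℝ)) *
        ‖dirDs (α.map eXi3 ++ βx.map eX3 ++ βy.map eY3) (a ε) (x, y, ξ)‖ ≤ C * ε ^ (-(N : ℤ))

/-- Nets of phase functions with parameter x ∈ Ω'. -/
def IsPhaseNet3 {q n p : ℕ} (Ω' : Set (Euc q)) (Ω : Set (Euc n))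
    (φ : ℝ → Euc q × Euc n × Euc p → ℝ) : Prop :=
  ∀ ε ∈ Set.Ioc (0:ℝ) 1,
    ContinuousOn (φ ε) (Ω' ×ˢ Ω ×ˢ (univ : Set (Euc p))) ∧
    ContDiffOn ℝ (⊤ : ℕ∞) (φ ε) (Ω' ×ˢ Ω ×ˢ {ξ : Euc p | ξ ≠ 0}) ∧
    (∀ x ∈ Ω', ∀ y ∈ Ω, ∀ ξ : Euc p, ξ ≠ 0 → ∀ t : ℝ, 0 < t →
      φ ε (x, y, t • ξ) = t * φ ε (x, y, ξ)) ∧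
    (∀ x ∈ Ω', ∀ y ∈ Ω, ∀ ξ : Euc p, ξ ≠ 0 → gradSq3 (φ ε) (x, y, ξ) ≠ 0)

/-- S^1_hg-moderateness in all variables for parametrized phase nets. -/
def Hg3Moderate {q n p : ℕ} (Ω' : Set (Euc q)) (Ω : Set (Euc n)) (m : ℝ)
    (φ : ℝ → Euc q × Euc n × Euc p → ℝ) : Prop :=
  ∀ K' ⊆ Ω', IsCompact K' → ∀ K ⊆ Ω, IsCompact K →
    ∀ (α : List (Fin p)) (βx : List (Fin q)) (βy : List (Fin n)),
    ∃ N : ℕ, ∃ C > 0, ∃ η ∈ Set.Ioc (0:ℝ) 1, ∀ ε ∈ Set.Ioc (0:ℝ) η,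
      ∀ x ∈ K', ∀ y ∈ K, ∀ ξ : Euc p, ξ ≠ 0 →
      ‖ξ‖ ^ (-m + (α.length : ℝ)) *
        ‖dirDs (α.map eXi3 ++ βx.map eX3 ++ βy.map eY3) (φ ε) (x, y, ξ)‖ ≤ C * ε ^ (-(N : ℤ))

def Hg3SlowScale {q n p : ℕ} (Ω' : Set (Euc q)) (Ω : Set (Euc n)) (m : ℝ)
    (φ : ℝ → Euc q × Euc n × Euc p → ℝ) : Prop :=
  ∀ K' ⊆ Ω', IsCompact K' → ∀ K ⊆ Ω, IsCompact K →
    ∀ (α : List (Fin p)) (βx : List (Fin q)) (βy : List (Fin n)),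
    ∃ s : ℝ → ℝ, SlowScale s ∧ ∃ η ∈ Set.Ioc (0:ℝ) 1, ∀ ε ∈ Set.Ioc (0:ℝ) η,
      ∀ x ∈ K', ∀ y ∈ K, ∀ ξ : Euc p, ξ ≠ 0 →
      ‖ξ‖ ^ (-m + (α.length : ℝ)) *
        ‖dirDs (α.map eXi3 ++ βx.map eX3 ++ βy.map eY3) (φ ε) (x, y, ξ)‖ ≤ s ε

/-- M_Φ(Ω';Ω×ℝ^p). -/
def MPhi3 {q n p : ℕ} (Ω' : Set (Euc q)) (Ω : Set (Euc n))
    (φ : ℝ → Euc q × Euc n × Euc p → ℝ) : Prop :=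
  IsPhaseNet3 Ω' Ω φ ∧ Hg3Moderate Ω' Ω 1 φ ∧
  ∀ K' ⊆ Ω', IsCompact K' → ∀ K ⊆ Ω, IsCompact K →
    ∃ r > (0:ℝ), ∃ η ∈ Set.Ioc (0:ℝ) 1, ∀ ε ∈ Set.Ioc (0:ℝ) η,
      ∀ x ∈ K', ∀ y ∈ K, ∀ ξ : Euc p, ξ ≠ 0 →
        ε ^ r ≤ gradSq3 (φ ε) (x, y, ‖ξ‖⁻¹ • ξ)

/-- M_{Φ,sc}(Ω';Ω×ℝ^p). -/
def MPhi3Sc {q n p : ℕ} (Ω' : Set (Euc q)) (Ω : Set (Euc n))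
    (φ : ℝ → Euc q × Euc n × Euc p → ℝ) : Prop :=
  IsPhaseNet3 Ω' Ω φ ∧ Hg3SlowScale Ω' Ω 1 φ ∧
  ∀ K' ⊆ Ω', IsCompact K' → ∀ K ⊆ Ω, IsCompact K →
    ∃ s : ℝ → ℝ, SlowScale s ∧ ∃ η ∈ Set.Ioc (0:ℝ) 1, ∀ ε ∈ Set.Ioc (0:ℝ) η,
      ∀ x ∈ K', ∀ y ∈ K, ∀ ξ : Euc p, ξ ≠ 0 →
        (s ε)⁻¹ ≤ gradSq3 (φ ε) (x, y, ‖ξ‖⁻¹ • ξ)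

def varphiN3 {q n p : ℕ} (φ : Euc q × Euc n × Euc p → ℝ) (z : Euc q × Euc n × Euc p) : ℝ :=
  (gradSq3 φ (z.1, z.2.1, ‖z.2.2‖⁻¹ • z.2.2))⁻¹

def coefA3 {q n p : ℕ} (χ : Euc p → ℝ) (φ : Euc q × Euc n × Euc p → ℝ) (j : Fin p) :
    Euc q × Euc n × Euc p → ℂ :=
  fun z => Complex.I * (((1 - χ z.2.2) * varphiN3 φ z * dirD (eXi3 j) φ z : ℝ) : ℂ)

def coefB3 {q n p : ℕ} (χ : Euc p → ℝ) (φ : Euc q × Euc n × Euc p → ℝ) (k : Fin n) :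
    Euc q × Euc n × Euc p → ℂ :=
  fun z => Complex.I * (((1 - χ z.2.2) * (‖z.2.2‖ ^ 2)⁻¹ * varphiN3 φ z * dirD (eY3 k) φ z : ℝ) : ℂ)

def coefC3 {q n p : ℕ} (χ : Euc p → ℝ) (φ : Euc q × Euc n × Euc p → ℝ) :
    Euc q × Euc n × Euc p → ℂ :=
  fun z => ((χ z.2.2 : ℝ) : ℂ) + (∑ j : Fin p, dirD (eXi3 j) (coefA3 χ φ j) z)
    + ∑ k : Fin n, dirD (eY3 k) (coefB3 χ φ k) z

/-- The operator L_φ(x;y,ξ,∂_y,∂_ξ). -/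
def Lop3 {q n p : ℕ} (χ : Euc p → ℝ) (φ : Euc q × Euc n × Euc p → ℝ)
    (f : Euc q × Euc n × Euc p → ℂ) : Euc q × Euc n × Euc p → ℂ :=
  fun z => (∑ j : Fin p, coefA3 χ φ j z * dirD (eXi3 j) f z)
    + (∑ k : Fin n, coefB3 χ φ k z * dirD (eY3 k) f z) + coefC3 χ φ z * f z


/-- Moderate net of order −∞ on Ω×ℝ^p. -/
def SmoothingModerate {n p : ℕ} (Ω : Set (Euc n)) (a : ℝ → Euc n × Euc p → ℂ) : Prop :=
  (∀ ε ∈ Set.Ioc (0:ℝ) 1, ContDiffOn ℝ (⊤ : ℕ∞) (a ε) (Ω ×ˢ (univ : Set (Euc p)))) ∧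
  (∀ ε ∈ Set.Ioc (0:ℝ) 1, ∀ m : ℝ, ∀ K ⊆ Ω, IsCompact K →
    ∀ (α : List (Fin p)) (β : List (Fin n)),
    ∃ C : ℝ, ∀ y ∈ K, ∀ ξ : Euc p,
      jb ξ ^ (-m + (α.length : ℝ)) *
        ‖dirDs (α.map eXi ++ β.map eY) (a ε) (y, ξ)‖ ≤ C) ∧
  ∀ m : ℝ, ∀ K ⊆ Ω, IsCompact K → ∀ (α : List (Fin p)) (β : List (Fin n)),
    ∃ N : ℕ, ∃ C > 0, ∃ η ∈ Set.Ioc (0:ℝ) 1, ∀ ε ∈ Set.Ioc (0:ℝ) η, ∀ y ∈ K, ∀ ξ : Euc p,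
      jb ξ ^ (-m + (α.length : ℝ)) *
        ‖dirDs (α.map eXi ++ β.map eY) (a ε) (y, ξ)‖ ≤ C * ε ^ (-(N : ℤ))

/-- Regular net of order −∞ on Ω×ℝ^p. -/
def SmoothingRegular {n p : ℕ} (Ω : Set (Euc n)) (a : ℝ → Euc n × Euc p → ℂ) : Prop :=
  (∀ ε ∈ Set.Ioc (0:ℝ) 1, ContDiffOn ℝ (⊤ : ℕ∞) (a ε) (Ω ×ˢ (univ : Set (Euc p)))) ∧
  (∀ ε ∈ Set.Ioc (0:ℝ) 1, ∀ m : ℝ, ∀ K ⊆ Ω, IsCompact K →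
    ∀ (α : List (Fin p)) (β : List (Fin n)),
    ∃ C : ℝ, ∀ y ∈ K, ∀ ξ : Euc p,
      jb ξ ^ (-m + (α.length : ℝ)) *
        ‖dirDs (α.map eXi ++ β.map eY) (a ε) (y, ξ)‖ ≤ C) ∧
  ∀ K ⊆ Ω, IsCompact K → ∃ N : ℕ, ∀ m : ℝ, ∀ (α : List (Fin p)) (β : List (Fin n)),
    ∃ C > 0, ∃ η ∈ Set.Ioc (0:ℝ) 1, ∀ ε ∈ Set.Ioc (0:ℝ) η, ∀ y ∈ K, ∀ ξ : Euc p,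
      jb ξ ^ (-m + (α.length : ℝ)) *
        ‖dirDs (α.map eXi ++ β.map eY) (a ε) (y, ξ)‖ ≤ C * ε ^ (-(N : ℤ))

/-- Moderate net in S^m_{ρ,δ}(V) on the conic set V = Ω×(ℝ^p∖0). -/
def ConicModerate {n p : ℕ} (Ω : Set (Euc n)) (m ρ δ : ℝ)
    (a : ℝ → Euc n × Euc p → ℂ) : Prop :=
  (∀ ε ∈ Set.Ioc (0:ℝ) 1, ContDiffOn ℝ (⊤ : ℕ∞) (a ε) (Ω ×ˢ {ξ : Euc p | ξ ≠ 0})) ∧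
  (∀ ε ∈ Set.Ioc (0:ℝ) 1, ∀ K ⊆ Ω ×ˢ {ξ : Euc p | ξ ≠ 0}, IsCompact K →
    ∀ (α : List (Fin p)) (β : List (Fin n)), ∃ C : ℝ, ∀ z ∈ K, ∀ t : ℝ, 1 ≤ t →
      jb (t • z.2) ^ (-m + ρ * (α.length : ℝ) - δ * (β.length : ℝ)) *
        ‖dirDs (α.map eXi ++ β.map eY) (a ε) (z.1, t • z.2)‖ ≤ C) ∧
  ∀ K ⊆ Ω ×ˢ {ξ : Euc p | ξ ≠ 0}, IsCompact K →
    ∀ (α : List (Fin p)) (β : List (Fin n)),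
    ∃ N : ℕ, ∃ C > 0, ∃ η ∈ Set.Ioc (0:ℝ) 1, ∀ ε ∈ Set.Ioc (0:ℝ) η, ∀ z ∈ K, ∀ t : ℝ, 1 ≤ t →
      jb (t • z.2) ^ (-m + ρ * (α.length : ℝ) - δ * (β.length : ℝ)) *
        ‖dirDs (α.map eXi ++ β.map eY) (a ε) (z.1, t • z.2)‖ ≤ C * ε ^ (-(N : ℤ))

/-- Negligible net in S^m_{ρ,δ}(V) on the conic set V = Ω×(ℝ^p∖0). -/
def ConicNegligible {n p : ℕ} (Ω : Set (Euc n)) (m ρ δ : ℝ)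
    (a : ℝ → Euc n × Euc p → ℂ) : Prop :=
  (∀ ε ∈ Set.Ioc (0:ℝ) 1, ContDiffOn ℝ (⊤ : ℕ∞) (a ε) (Ω ×ˢ {ξ : Euc p | ξ ≠ 0})) ∧
  (∀ ε ∈ Set.Ioc (0:ℝ) 1, ∀ K ⊆ Ω ×ˢ {ξ : Euc p | ξ ≠ 0}, IsCompact K →
    ∀ (α : List (Fin p)) (β : List (Fin n)), ∃ C : ℝ, ∀ z ∈ K, ∀ t : ℝ, 1 ≤ t →
      jb (t • z.2) ^ (-m + ρ * (α.length : ℝ) - δ * (β.length : ℝ)) *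
        ‖dirDs (α.map eXi ++ β.map eY) (a ε) (z.1, t • z.2)‖ ≤ C) ∧
  ∀ K ⊆ Ω ×ˢ {ξ : Euc p | ξ ≠ 0}, IsCompact K →
    ∀ (α : List (Fin p)) (β : List (Fin n)), ∀ q : ℕ,
    ∃ C > 0, ∃ η ∈ Set.Ioc (0:ℝ) 1, ∀ ε ∈ Set.Ioc (0:ℝ) η, ∀ z ∈ K, ∀ t : ℝ, 1 ≤ t →
      jb (t • z.2) ^ (-m + ρ * (α.length : ℝ) - δ * (β.length : ℝ)) *
        ‖dirDs (α.map eXi ++ β.map eY) (a ε) (z.1, t • z.2)‖ ≤ C * ε ^ q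

/-- A point (x₀,ξ₀) at which |∇_ξφ|² is invertible on a neighborhood U×Γ. -/
def InvPt {n p : ℕ} (Ω : Set (Euc n)) (φ : ℝ → Euc n × Euc p → ℝ)
    (z : Euc n × Euc p) : Prop :=
  ∃ U : Set (Euc n), IsOpen U ∧ z.1 ∈ U ∧ U ⊆ Ω ∧ IsCompact (closure U) ∧
  ∃ Γ : Set (Euc p), IsOpen Γ ∧ z.2 ∈ Γ ∧ (∀ ξ ∈ Γ, ∀ t : ℝ, 0 < t → t • ξ ∈ Γ) ∧
  ∃ r : ℝ, ∃ η ∈ Set.Ioc (0:ℝ) 1, ∀ ε ∈ Set.Ioc (0:ℝ) η, ∀ y ∈ U, ∀ ξ ∈ Γ,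
    ε ^ r ≤ gradXiSq (φ ε) (y, ξ)

/-- A point (x₀,ξ₀) at which |∇_ξφ|² is slow scale-invertible on a neighborhood U×Γ. -/
def InvPtSc {n p : ℕ} (Ω : Set (Euc n)) (φ : ℝ → Euc n × Euc p → ℝ)
    (z : Euc n × Euc p) : Prop :=
  ∃ U : Set (Euc n), IsOpen U ∧ z.1 ∈ U ∧ U ⊆ Ω ∧ IsCompact (closure U) ∧
  ∃ Γ : Set (Euc p), IsOpen Γ ∧ z.2 ∈ Γ ∧ (∀ ξ ∈ Γ, ∀ t : ℝ, 0 < t → t • ξ ∈ Γ) ∧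
  ∃ s : ℝ → ℝ, SlowScale s ∧ ∃ η ∈ Set.Ioc (0:ℝ) 1, ∀ ε ∈ Set.Ioc (0:ℝ) η, ∀ y ∈ U, ∀ ξ ∈ Γ,
    (s ε)⁻¹ ≤ gradXiSq (φ ε) (y, ξ)

/-- The set C_φ. -/
def Cphi {n p : ℕ} (Ω : Set (Euc n)) (φ : ℝ → Euc n × Euc p → ℝ) : Set (Euc n × Euc p) :=
  {z | z.1 ∈ Ω ∧ z.2 ≠ 0 ∧ ¬ InvPt Ω φ z}

/-- The set R_φ = Ω ∖ π_Ω(C_φ). -/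
def Rphi {n p : ℕ} (Ω : Set (Euc n)) (φ : ℝ → Euc n × Euc p → ℝ) : Set (Euc n) :=
  Ω \ (Prod.fst '' Cphi Ω φ)

/-- The set C^sc_φ. -/
def CphiSc {n p : ℕ} (Ω : Set (Euc n)) (φ : ℝ → Euc n × Euc p → ℝ) : Set (Euc n × Euc p) :=
  {z | z.1 ∈ Ω ∧ z.2 ≠ 0 ∧ ¬ InvPtSc Ω φ z}

/-- The set R^sc_φ = Ω ∖ π_Ω(C^sc_φ). -/
def RphiSc {n p : ℕ} (Ω : Set (Euc n)) (φ : ℝ → Euc n × Euc p → ℝ) : Set (Euc n) :=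
  Ω \ (Prod.fst '' CphiSc Ω φ)

/-- 1/|∇_ξφ(y,ξ/|ξ|)|². -/
def varphiXi {n p : ℕ} (φ : Euc n × Euc p → ℝ) (z : Euc n × Euc p) : ℝ :=
  (gradXiSq φ (z.1, ‖z.2‖⁻¹ • z.2))⁻¹

/-- The transposed regularizing operator in the ξ-variables only:
    ᵗL f = −Σ_j a_j ∂_{ξ_j} f + χ f  with a_j = i(1−χ)|∇_ξφ|⁻²∂_{ξ_j}φ. -/
def tLxi {n p : ℕ} (χ : Euc p → ℝ) (φ : Euc n × Euc p → ℝ) (f : Euc n × Euc p → ℂ) :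
    Euc n × Euc p → ℂ :=
  fun z => -(∑ j : Fin p,
      (Complex.I * (((1 - χ z.2) * varphiXi φ z * dirD (eXi j) φ z : ℝ) : ℂ)) *
        dirD (eXi j) f z)
    + ((χ z.2 : ℝ) : ℂ) * f z

/-- d_{j}(y,θ,ξ) = (ξ_j − ∂_{y_j}φ(y,θ))/|ξ−∇_yφ(y,θ)|². -/
def dj {n p : ℕ} (φ : Euc n × Euc p → ℝ) (ξ : Euc n) (j : Fin n)
    (z : Euc n × Euc p) : ℝ :=
  (ξ j - dirD (eY j) φ z) / ‖ξ - gradY φ z‖ ^ 2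

/-- ᵗL_ε f = −Σ_j d_j D_{y_j} f − Σ_j (D_{y_j} d_j) f, with D_{y_j} = −i∂_{y_j}. -/
def tLW {n p : ℕ} (φ : Euc n × Euc p → ℝ) (ξ : Euc n) (f : Euc n × Euc p → ℂ) :
    Euc n × Euc p → ℂ :=
  fun z => -(∑ j : Fin n, ((dj φ ξ j z : ℝ) : ℂ) * (-Complex.I * dirD (eY j) f z))
    - ∑ j : Fin n, (-Complex.I * ((dirD (eY j) (dj φ ξ j) z : ℝ) : ℂ)) * f z

section DirectionalDerivatives

variable {E F : Type*} [NormedAddCommGroup E] [NormedSpace ℝ E]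
  [NormedAddCommGroup F] [NormedSpace ℝ F]

theorem dirDs_append_singleton (L : List E) (v : E) (f : E → F) :
    dirDs (L ++ [v]) f = dirDs L (dirD v f) := by
  simp [dirDs, List.foldr_append]

theorem ContDiffOn.dirD {V : Set E} (hV : IsOpen V) {f : E → F}
    (hf : ContDiffOn ℝ (⊤ : ℕ∞) f V) (v : E) : ContDiffOn ℝ (⊤ : ℕ∞) (dirD v f) V :=
  (hf.fderiv_of_isOpen hV (by simp)).clm_apply contDiffOn_const

theorem ContDiffOn.dirDs {V : Set E} (hV : IsOpen V) {f : E → F}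
    (hf : ContDiffOn ℝ (⊤ : ℕ∞) f V) (L : List E) : ContDiffOn ℝ (⊤ : ℕ∞) (dirDs L f) V := by
  induction L with
  | nil => exact hf
  | cons v L ih => exact ih.dirD hV v

theorem ContDiffOn.differentiableAt_of_isOpen {V : Set E} (hV : IsOpen V) {f : E → F}
    (hf : ContDiffOn ℝ (⊤ : ℕ∞) f V) {z : E} (hz : z ∈ V) : DifferentiableAt ℝ f z :=
  (hf.contDiffAt (hV.mem_nhds hz)).differentiableAt (by simp)

theorem Set.EqOn.dirD {V : Set E} (hV : IsOpen V) {f g : E → F} (h : EqOn f g V) (v : E) :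
    EqOn (dirD v f) (dirD v g) V := fun z hz => by
  simp only [_root_.dirD, (h.eventuallyEq_of_mem (hV.mem_nhds hz)).fderiv_eq]

theorem Set.EqOn.dirDs {V : Set E} (hV : IsOpen V) {f g : E → F} (h : EqOn f g V)
    (L : List E) : EqOn (dirDs L f) (dirDs L g) V := by
  induction L with
  | nil => exact h
  | cons v L ih => exact ih.dirD hV v

theorem dirDs_add {V : Set E} (hV : IsOpen V) {f g : E → F}
    (hf : ContDiffOn ℝ (⊤ : ℕ∞) f V) (hg : ContDiffOn ℝ (⊤ : ℕ∞) g V) (L : List E) :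
    EqOn (dirDs L (fun z => f z + g z)) (fun z => dirDs L f z + dirDs L g z) V := by
  induction L with
  | nil => exact fun z _ => rfl
  | cons v L ih =>
    intro z hz
    refine (ih.dirD hV v hz).trans ?_
    have h1 := (hf.dirDs hV L).differentiableAt_of_isOpen hV hz
    have h2 := (hg.dirDs hV L).differentiableAt_of_isOpen hV hz
    simp only [dirD, dirDs, List.foldr_cons] at h1 h2 ⊢
    rw [fderiv_fun_add h1 h2]
    rfl

theorem dirDs_clm_comp {G : Type*} [NormedAddCommGroup G] [NormedSpace ℝ G]
    {V : Set E} (hV : IsOpen V) {f : E → F}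
    (hf : ContDiffOn ℝ (⊤ : ℕ∞) f V) (T : F →L[ℝ] G) (L : List E) :
    EqOn (dirDs L (fun z => T (f z))) (fun z => T (dirDs L f z)) V := by
  induction L with
  | nil => exact fun z _ => rfl
  | cons v L ih =>
    intro z hz
    refine (ih.dirD hV v hz).trans ?_
    have h1 := (hf.dirDs hV L).differentiableAt_of_isOpen hV hz
    have := (T.hasFDerivAt.comp z h1.hasFDerivAt).fderiv
    simp only [Function.comp_def] at this
    simp only [dirD]
    rw [this]
    rfl

theorem dirD_mul {V : Set E} (hV : IsOpen V) {f g : E → ℂ}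
    (hf : ContDiffOn ℝ (⊤ : ℕ∞) f V) (hg : ContDiffOn ℝ (⊤ : ℕ∞) g V) (v : E) :
    EqOn (dirD v (fun z => f z * g z)) (fun z => dirD v f z * g z + f z * dirD v g z) V := by
  intro z hz
  simp only [dirD]
  rw [fderiv_fun_mul (hf.differentiableAt_of_isOpen hV hz) (hg.differentiableAt_of_isOpen hV hz)]
  simp only [add_apply, smul_apply, smul_eq_mul]
  ring

theorem dirD_cexp_I_mul {V : Set E} (hV : IsOpen V) {ψ : E → ℝ}
    (hψ : ContDiffOn ℝ (⊤ : ℕ∞) ψ V) (v : E) :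
    EqOn (dirD v (fun z => Complex.exp (Complex.I * ((ψ z : ℝ) : ℂ))))
      (fun z => (Complex.I * ((dirD v ψ z : ℝ) : ℂ)) *
        Complex.exp (Complex.I * ((ψ z : ℝ) : ℂ))) V := by
  intro z hz
  have h1 := (hψ.differentiableAt_of_isOpen hV hz).hasFDerivAt
  have h2 : HasFDerivAt (fun z => ((ψ z : ℝ) : ℂ)) (Complex.ofRealCLM.comp (fderiv ℝ ψ z)) z :=
    Complex.ofRealCLM.hasFDerivAt.comp z h1
  simp only [dirD]
  rw [((h2.const_mul Complex.I).cexp).fderiv]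
  simp only [smul_apply, smul_eq_mul, ContinuousLinearMap.comp_apply, Complex.ofRealCLM_apply]
  ring

theorem contDiffOn_cexp_I_mul {V : Set E} {ψ : E → ℝ} (hψ : ContDiffOn ℝ (⊤ : ℕ∞) ψ V) :
    ContDiffOn ℝ (⊤ : ℕ∞) (fun z => Complex.exp (Complex.I * ((ψ z : ℝ) : ℂ))) V :=
  (contDiffOn_const.mul (Complex.ofRealCLM.contDiff.comp_contDiffOn hψ)).cexp

/-- Leibniz estimate for iterated directional derivatives of a product. -/
theorem norm_dirDs_mul_le {V : Set E} (hV : IsOpen V) (W : E → ℝ) {z : E} (hz : z ∈ V)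
    (L : List E) {f g : E → ℂ} (hf : ContDiffOn ℝ (⊤ : ℕ∞) f V)
    (hg : ContDiffOn ℝ (⊤ : ℕ∞) g V) {A B : ℝ}
    (hA : ∀ S, S.Sublist L → ‖dirDs S f z‖ ≤ A * (S.map W).prod)
    (hB : ∀ S, S.Sublist L → ‖dirDs S g z‖ ≤ B * (S.map W).prod) :
    ‖dirDs L (fun z => f z * g z) z‖ ≤ 2 ^ L.length * A * B * (L.map W).prod := by
  induction L using List.reverseRecOn generalizing f g A B with
  | nil =>
    have h1 := hA [] (List.Sublist.refl _)
    have h2 := hB [] (List.Sublist.refl _)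
    simp only [List.map_nil, List.prod_nil, mul_one, List.length_nil, pow_zero, one_mul] at h1 h2 ⊢
    change ‖f z * g z‖ ≤ _
    rw [norm_mul]
    exact mul_le_mul h1 h2 (norm_nonneg _) ((norm_nonneg _).trans h1)
  | append_singleton L v ih =>
    have hsub : ∀ S : List E, S.Sublist L → S.Sublist (L ++ [v]) := fun S hS =>
      hS.trans (List.sublist_append_left _ _)
    have hsub' : ∀ S : List E, S.Sublist L → (S ++ [v]).Sublist (L ++ [v]) := fun S hS =>
      hS.append (List.Sublist.refl _)
    have e1 := ih (A := A * W v) (B := B) (hf.dirD hV v) hg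
      (fun S hS => by
        have := hA _ (hsub' S hS)
        rw [dirDs_append_singleton] at this
        refine this.trans (le_of_eq ?_)
        simp; ring)
      (fun S hS => hB S (hsub S hS))
    have e2 := ih (A := A) (B := B * W v) hf (hg.dirD hV v)
      (fun S hS => hA S (hsub S hS))
      (fun S hS => by
        have := hB _ (hsub' S hS)
        rw [dirDs_append_singleton] at this
        refine this.trans (le_of_eq ?_)
        simp; ring)
    rw [dirDs_append_singleton, (dirD_mul hV hf hg v).dirDs hV L hz,
      dirDs_add hV ((hf.dirD hV v).mul hg) (hf.mul (hg.dirD hV v)) L hz]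
    refine (norm_add_le _ _).trans ((add_le_add e1 e2).trans (le_of_eq ?_))
    simp [pow_succ]; ring

/-- Weighted bounds on the derivatives of `ψ` give weighted bounds on those of `e^{iψ}`. -/
theorem norm_dirDs_cexp_le {V : Set E} (hV : IsOpen V) {W : E → ℝ} (hW : ∀ v, 0 ≤ W v)
    {z : E} (hz : z ∈ V) {ψ : E → ℝ} (hψ : ContDiffOn ℝ (⊤ : ℕ∞) ψ V) {A : ℝ} (hA1 : 1 ≤ A)
    (L : List E)
    (hA : ∀ S, S.Sublist L → S ≠ [] → ‖dirDs S ψ z‖ ≤ A * (S.map W).prod) :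
    ∀ S, S.Sublist L → ‖dirDs S (fun z => Complex.exp (Complex.I * ((ψ z : ℝ) : ℂ))) z‖ ≤
      (2 ^ L.length * A) ^ L.length * (S.map W).prod := by
  have hprod : ∀ S : List E, 0 ≤ (S.map W).prod := fun S =>
    List.prod_nonneg (by simpa using fun v _ => hW v)
  induction L using List.reverseRecOn with
  | nil =>
    intro S hS
    rw [List.sublist_nil.1 hS]
    change ‖Complex.exp (Complex.I * ((ψ z : ℝ) : ℂ))‖ ≤ _
    simp [mul_comm Complex.I]
  | append_singleton L v ih =>
    have ih := ih fun S hS => hA S (hS.trans (List.sublist_append_left _ _))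
    set k := L.length with hk
    have hbase : (1 : ℝ) ≤ 2 ^ k * A := one_le_mul_of_one_le_of_one_le (one_le_pow₀ (by norm_num)) hA1
    have hmono : 2 ^ k * A * (2 ^ k * A) ^ k ≤ (2 ^ (k + 1) * A) ^ (k + 1) := by
      rw [← pow_succ']
      gcongr <;> norm_num
    intro S hS
    rw [List.length_append, List.length_singleton, ← hk]
    obtain ⟨S₁, S₂, rfl, h₁, h₂⟩ := List.sublist_append_iff.1 hS
    rcases List.sublist_singleton.1 h₂ with rfl | rfl
    · rw [List.append_nil]
      refine (ih S₁ h₁).trans (mul_le_mul_of_nonneg_right (le_trans ?_ hmono) (hprod _))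
      exact le_mul_of_one_le_left (by positivity) hbase
    · rw [dirDs_append_singleton, (dirD_cexp_I_mul hV hψ v).dirDs hV S₁ hz]
      have key := norm_dirDs_mul_le hV W hz S₁
        (f := fun z => Complex.I * ((dirD v ψ z : ℝ) : ℂ))
        (A := A * W v) (B := (2 ^ k * A) ^ k)
        (contDiffOn_const.mul (Complex.ofRealCLM.contDiff.comp_contDiffOn (hψ.dirD hV v)))
        (contDiffOn_cexp_I_mul hψ)
        (fun S hS => by
          have e := dirDs_clm_comp hV (hψ.dirD hV v) (Complex.I • Complex.ofRealCLM) S hz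
          simp only [smul_apply, Complex.ofRealCLM_apply, smul_eq_mul] at e
          rw [e, ← dirDs_append_singleton, norm_mul, Complex.norm_I, one_mul, Complex.norm_real]
          refine (hA _ ((hS.trans h₁).append (List.Sublist.refl _)) (by simp)).trans (le_of_eq ?_)
          simp; ring)
        (fun S hS => ih S (hS.trans h₁))
      refine key.trans ?_
      have hlen : (2 : ℝ) ^ S₁.length ≤ 2 ^ k :=
        pow_le_pow_right₀ (by norm_num) h₁.length_le
      rw [List.map_append, List.prod_append, List.map_singleton, List.prod_singleton]
      calc 2 ^ S₁.length * (A * W v) * (2 ^ k * A) ^ k * (S₁.map W).prod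
          = 2 ^ S₁.length * (A * (2 ^ k * A) ^ k * ((S₁.map W).prod * W v)) := by ring
        _ ≤ 2 ^ k * (A * (2 ^ k * A) ^ k * ((S₁.map W).prod * W v)) := by
            refine mul_le_mul_of_nonneg_right hlen ?_
            have := hprod S₁
            have := hW v
            positivity
        _ = (2 ^ k * A * (2 ^ k * A) ^ k) * ((S₁.map W).prod * W v) := by ring
        _ ≤ _ := mul_le_mul_of_nonneg_right hmono (mul_nonneg (hprod _) (hW v))

end DirectionalDerivatives

section Homogeneity

variable {n p : ℕ} {Ω : Set (Euc n)}

theorem isOpen_prod_ne_zero (hΩ : IsOpen Ω) : IsOpen (Ω ×ˢ {ξ : Euc p | ξ ≠ 0}) :=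
  hΩ.prod isOpen_ne

theorem dirD_homogeneous (hΩ : IsOpen Ω) {f : Euc n × Euc p → ℝ}
    (hf : ContDiffOn ℝ (⊤ : ℕ∞) f (Ω ×ˢ {ξ : Euc p | ξ ≠ 0})) {m j : ℤ} {v : Euc n × Euc p}
    (hv : ∀ t : ℝ, 0 < t → (v.1, t • v.2) = t ^ j • v)
    (hm : ∀ z ∈ Ω ×ˢ {ξ : Euc p | ξ ≠ 0}, ∀ t : ℝ, 0 < t → f (z.1, t • z.2) = t ^ m * f z) :
    ∀ z ∈ Ω ×ˢ {ξ : Euc p | ξ ≠ 0}, ∀ t : ℝ, 0 < t →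
      dirD v f (z.1, t • z.2) = t ^ (m - j) * dirD v f z := by
  intro z hz t ht
  have hV := isOpen_prod_ne_zero (p := p) hΩ
  let s : (Euc n × Euc p) →L[ℝ] (Euc n × Euc p) :=
    (ContinuousLinearMap.id ℝ (Euc n)).prodMap (t • ContinuousLinearMap.id ℝ (Euc p))
  have hs : ∀ w, s w = (w.1, t • w.2) := fun w => rfl
  have hsz : s z ∈ Ω ×ˢ {ξ : Euc p | ξ ≠ 0} := ⟨hz.1, smul_ne_zero ht.ne' hz.2⟩
  have h1 : HasFDerivAt (f ∘ s) ((fderiv ℝ f (s z)).comp s) z :=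
    (hf.differentiableAt_of_isOpen hV hsz).hasFDerivAt.comp z s.hasFDerivAt
  have h2 : HasFDerivAt (fun w => t ^ m * f w) (t ^ m • fderiv ℝ f z) z :=
    (hf.differentiableAt_of_isOpen hV hz).hasFDerivAt.const_mul _
  have heq : f ∘ s =ᶠ[𝓝 z] fun w => t ^ m * f w := by
    filter_upwards [hV.mem_nhds hz] with w hw using hm w hw t ht
  have h3 := congrArg (fun T => T v) ((h1.congr_of_eventuallyEq heq.symm).unique h2)
  simp only [ContinuousLinearMap.comp_apply, smul_apply, smul_eq_mul] at h3
  rw [hs v, hv t ht, map_smul, smul_eq_mul] at h3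
  have ht' : t ^ j ≠ 0 := zpow_ne_zero _ ht.ne'
  change fderiv ℝ f (s z) v = _ * fderiv ℝ f z v
  rw [zpow_sub₀ ht.ne', div_mul_eq_mul_div, eq_div_iff ht', ← h3, mul_comm]

theorem dirDs_homogeneous (hΩ : IsOpen Ω) {f : Euc n × Euc p → ℝ}
    (hf : ContDiffOn ℝ (⊤ : ℕ∞) f (Ω ×ˢ {ξ : Euc p | ξ ≠ 0})) {m : ℤ}
    (hm : ∀ z ∈ Ω ×ˢ {ξ : Euc p | ξ ≠ 0}, ∀ t : ℝ, 0 < t → f (z.1, t • z.2) = t ^ m * f z)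
    (α : List (Fin p)) (β : List (Fin n)) :
    ∀ z ∈ Ω ×ˢ {ξ : Euc p | ξ ≠ 0}, ∀ t : ℝ, 0 < t →
      dirDs (α.map eXi ++ β.map eY) f (z.1, t • z.2) =
        t ^ (m - α.length) * dirDs (α.map eXi ++ β.map eY) f z := by
  have hV := isOpen_prod_ne_zero (p := p) hΩ
  induction α with
  | nil =>
    induction β with
    | nil => simpa [dirDs] using hm
    | cons k β ih =>
      have := dirD_homogeneous hΩ (hf.dirDs hV _) (v := eY k) (j := 0)
        (fun t _ => by simp [eY]) ih
      simpa [dirDs] using this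
  | cons i α ih =>
    have := dirD_homogeneous hΩ (hf.dirDs hV _) (v := eXi i) (j := 1)
      (fun t _ => by simp [eXi]) ih
    simpa [dirDs, sub_sub] using this

theorem one_le_jb (ξ : Euc p) : 1 ≤ jb ξ :=
  Real.one_le_sqrt.2 (by nlinarith [sq_nonneg ‖ξ‖])

theorem norm_le_jb (ξ : Euc p) : ‖ξ‖ ≤ jb ξ :=
  Real.le_sqrt_of_sq_le (by linarith)

/-- A compact subset of `Ω × (ℝ^p ∖ 0)` stays at a positive distance from `ξ = 0`. -/
theorem exists_le_norm_snd {K : Set (Euc n × Euc p)} (hK : IsCompact K)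
    (hKs : K ⊆ Ω ×ˢ {ξ : Euc p | ξ ≠ 0}) : ∃ c : ℝ, 0 < c ∧ c ≤ 1 ∧ ∀ z ∈ K, c ≤ ‖z.2‖ := by
  rcases K.eq_empty_or_nonempty with rfl | hne
  · exact ⟨1, one_pos, le_rfl, by simp⟩
  · obtain ⟨z₀, hz₀, hmin⟩ := hK.exists_isMinOn hne (continuous_snd.norm.continuousOn)
    exact ⟨min 1 ‖z₀.2‖, lt_min one_pos (norm_pos_iff.2 (hKs hz₀).2), min_le_left _ _,
      fun z hz => (min_le_right _ _).trans (hmin hz)⟩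

theorem le_of_rpow_mul_le {x c J D A : ℝ} (hc : 0 < c) (hc1 : c ≤ 1) (hcx : c ≤ x)
    (hxJ : x ≤ J) (hJ : 1 ≤ J) (hD : 0 ≤ D) {a b : ℕ} (hab : a ≠ 0 ∨ b ≠ 0)
    (h : x ^ (-1 + (a : ℝ)) * D ≤ A) : D ≤ A * c⁻¹ ^ a * J ^ b := by
  have hx : 0 < x := hc.trans_le hcx
  have hA : 0 ≤ A := le_trans (by positivity) h
  have hc' : 1 ≤ c⁻¹ := (one_le_inv₀ hc).2 hc1
  have hxc : x⁻¹ ≤ c⁻¹ := inv_anti₀ hc hcx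
  have h1 : D ≤ A * (x * x⁻¹ ^ a) := by
    rw [Real.rpow_add hx, Real.rpow_neg_one, Real.rpow_natCast] at h
    calc D = (x⁻¹ * x ^ a * D) * (x * x⁻¹ ^ a) := by
          rw [inv_pow]; field_simp
      _ ≤ _ := by gcongr
  refine h1.trans ?_
  rw [mul_assoc]
  refine mul_le_mul_of_nonneg_left ?_ hA
  rcases Nat.eq_zero_or_pos b with rfl | hb
  · obtain ⟨a, rfl⟩ := Nat.exists_eq_succ_of_ne_zero (hab.resolve_right (by simp))
    rw [Nat.succ_eq_add_one, pow_succ', ← mul_assoc, mul_inv_cancel₀ hx.ne', one_mul, pow_zero,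
      mul_one]
    calc x⁻¹ ^ a ≤ c⁻¹ ^ a := by gcongr
      _ ≤ c⁻¹ ^ (a + 1) := pow_le_pow_right₀ hc' (Nat.le_succ a)
  · rw [mul_comm]
    have : J ≤ J ^ b := le_self_pow₀ hJ hb.ne'
    gcongr
    exact hxJ.trans this

/-- Degree-one homogeneous bounds on the derivatives of `ψ` at `(y, ξ)` bound the derivatives of
`e^{iψ}` there. -/
theorem jb_rpow_mul_norm_dirDs_cexp_le (hΩ : IsOpen Ω) {ψ : Euc n × Euc p → ℝ}
    (hψ : ContDiffOn ℝ (⊤ : ℕ∞) ψ (Ω ×ˢ {ξ : Euc p | ξ ≠ 0})) (α : List (Fin p))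
    (β : List (Fin n)) {c A : ℝ} (hc : 0 < c) (hc1 : c ≤ 1) (hA1 : 1 ≤ A) {y : Euc n} {ξ : Euc p}
    (hy : y ∈ Ω) (hξ : c ≤ ‖ξ‖)
    (hA : ∀ α' ∈ α.sublists, ∀ β' ∈ β.sublists,
      ‖ξ‖ ^ (-1 + (α'.length : ℝ)) * ‖dirDs (α'.map eXi ++ β'.map eY) ψ (y, ξ)‖ ≤ A) :
    jb ξ ^ (-0 + 0 * (α.length : ℝ) - 1 * (β.length : ℝ)) *
      ‖dirDs (α.map eXi ++ β.map eY)
        (fun z => Complex.exp (Complex.I * ((ψ z : ℝ) : ℂ))) (y, ξ)‖ ≤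
      (2 ^ (α.length + β.length) * (A * c⁻¹ ^ α.length)) ^ (α.length + β.length) := by
  have hV := isOpen_prod_ne_zero (p := p) hΩ
  have hJ := one_le_jb ξ
  have hc' : 1 ≤ c⁻¹ := (one_le_inv₀ hc).2 hc1
  let W : Euc n × Euc p → ℝ := fun v => if v.2 = 0 then jb ξ else 1
  have hWξ : ∀ i, W (eXi i) = 1 := fun i => by simp [W, eXi]
  have hWy : ∀ k, W (eY k) = jb ξ := fun k => by simp [W, eY]
  have hWp : ∀ (α : List (Fin p)) (β : List (Fin n)),
      ((α.map eXi ++ β.map eY).map W).prod = jb ξ ^ β.length := fun α β => by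
    simp [Function.comp_def, hWξ, hWy]
  have key := norm_dirDs_cexp_le hV (W := W)
    (fun v => by dsimp only [W]; split_ifs <;> linarith)
    (z := (y, ξ)) ⟨hy, norm_pos_iff.1 (hc.trans_le hξ)⟩ hψ (A := A * c⁻¹ ^ α.length)
    (one_le_mul_of_one_le_of_one_le hA1 (one_le_pow₀ hc')) (α.map eXi ++ β.map eY)
    (fun S hS hS0 => by
      obtain ⟨S₁, S₂, rfl, h₁, h₂⟩ := List.sublist_append_iff.1 hS
      obtain ⟨α', hα', rfl⟩ := List.sublist_map_iff.1 h₁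
      obtain ⟨β', hβ', rfl⟩ := List.sublist_map_iff.1 h₂
      rw [hWp]
      have := le_of_rpow_mul_le hc hc1 hξ (norm_le_jb ξ) hJ (norm_nonneg _)
        (a := α'.length) (b := β'.length)
        (by by_contra! h; simp_all [List.length_eq_zero_iff])
        (hA α' (List.mem_sublists.2 hα') β' (List.mem_sublists.2 hβ'))
      refine this.trans ?_
      have := pow_le_pow_right₀ hc' hα'.length_le
      gcongr)
    _ (List.Sublist.refl _)
  rw [hWp] at key
  have hJ0 : 0 < jb ξ := by linarith
  rw [show -0 + 0 * (α.length : ℝ) - 1 * (β.length : ℝ) = -(β.length : ℝ) by ring,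
    Real.rpow_neg hJ0.le, Real.rpow_natCast, inv_mul_le_iff₀ (by positivity), mul_comm]
  simpa using key

end Homogeneity

/-- part of Proposition on e^{iφ}: for (φ_ε) ∈ M_Φ(Ω×ℝ^p), the net
(e^{iφ_ε})_ε is a moderate net in S^0_{0,1}(Ω×(ℝ^p∖0)). -/
theorem stmt6 {n p : ℕ} (Ω : Set (Euc n)) (hΩ : IsOpen Ω)
    (φ : ℝ → Euc n × Euc p → ℝ) (hφ : MPhi Ω φ) :
    ConicModerate Ω 0 0 1
      (fun ε z => Complex.exp (Complex.I * ((φ ε z : ℝ) : ℂ))) := by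
  obtain ⟨hphase, hmod, -⟩ := hφ
  have hV := isOpen_prod_ne_zero (p := p) hΩ
  have hscale : ∀ {c t : ℝ} {ξ : Euc p}, c ≤ ‖ξ‖ → 1 ≤ t → c ≤ ‖t • ξ‖ := fun {c t ξ} hc ht => by
    rw [norm_smul, Real.norm_of_nonneg (by linarith)]
    nlinarith [norm_nonneg ξ]
  refine ⟨fun ε hε => contDiffOn_cexp_I_mul (hphase ε hε).1, fun ε hε K hKs hK α β => ?_,
    fun K hKs hK α β => ?_⟩
  · obtain ⟨hsm, hhom, -⟩ := hphase ε hε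
    obtain ⟨c, hc, hc1, hcK⟩ := exists_le_norm_snd hK hKs
    have hbd : ∀ q : List (Fin p) × List (Fin n), ∃ A : ℝ, ∀ z ∈ K, ∀ t : ℝ, 1 ≤ t →
        ‖t • z.2‖ ^ (-1 + (q.1.length : ℝ)) *
          ‖dirDs (q.1.map eXi ++ q.2.map eY) (φ ε) (z.1, t • z.2)‖ ≤ A := by
      rintro ⟨α', β'⟩
      have hcont : ContinuousOn (fun z : Euc n × Euc p => ‖z.2‖ ^ (-1 + (α'.length : ℝ)) *
          ‖dirDs (α'.map eXi ++ β'.map eY) (φ ε) z‖) K := by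
        refine ContinuousOn.mul ?_ ((hsm.dirDs hV _).continuousOn.mono hKs).norm
        exact continuous_snd.norm.continuousOn.rpow_const
          fun z hz => Or.inl (norm_ne_zero_iff.2 (hKs hz).2)
      obtain ⟨A, hA⟩ := hK.bddAbove_image hcont
      refine ⟨A, fun z hz t ht => ?_⟩
      have ht0 : 0 < t := by linarith
      have hh := dirDs_homogeneous hΩ hsm (m := 1)
        (fun z hz t ht => by simpa using hhom z.1 hz.1 z.2 hz.2 t ht) α' β' z (hKs hz) t ht0
      refine le_trans (le_of_eq ?_) (hA (mem_image_of_mem _ hz))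
      dsimp only
      rw [hh, norm_smul, norm_mul, Real.norm_of_nonneg ht0.le,
        Real.norm_of_nonneg (zpow_nonneg ht0.le _), Real.mul_rpow ht0.le (norm_nonneg _),
        ← Real.rpow_intCast]
      have : t ^ (-1 + (α'.length : ℝ)) * t ^ (((1 - α'.length : ℤ)) : ℝ) = 1 := by
        rw [← Real.rpow_add ht0]; simp
      linear_combination (‖z.2‖ ^ (-1 + (α'.length : ℝ)) *
        ‖dirDs (α'.map eXi ++ β'.map eY) (φ ε) z‖) * this
    choose A hA using hbd
    obtain ⟨B, hB⟩ := ((α.sublists.toFinset ×ˢ β.sublists.toFinset).image A).exists_le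
    refine ⟨_, fun z hz t ht => jb_rpow_mul_norm_dirDs_cexp_le hΩ hsm α β hc hc1
      (le_max_left 1 B) (hKs hz).1 (hscale (hcK z hz) ht) fun α' hα' β' hβ' => ?_⟩
    refine ((hA (α', β') z hz t ht).trans (hB _ ?_)).trans (le_max_right _ _)
    exact Finset.mem_image_of_mem _ (by simp_all)
  · obtain ⟨c, hc, hc1, hcK⟩ := exists_le_norm_snd hK hKs
    have hK1 : Prod.fst '' K ⊆ Ω := by
      rintro _ ⟨z, hz, rfl⟩
      exact (hKs hz).1
    have hm := fun q : List (Fin p) × List (Fin n) =>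
      hmod _ hK1 (hK.image continuous_fst) q.1 q.2
    choose N C hC η hη hb using hm
    let s := α.sublists.toFinset ×ˢ β.sublists.toFinset
    have hs : s.Nonempty := ⟨(α, β), by simp [s]⟩
    obtain ⟨M, hM⟩ := (s.image N).exists_le
    obtain ⟨B, hB⟩ := (s.image C).exists_le
    set k := α.length + β.length with hk
    refine ⟨M * k, (2 ^ k * (max 1 B * c⁻¹ ^ α.length)) ^ k, by positivity, s.inf' hs η, ?_, ?_⟩
    · exact ⟨(Finset.lt_inf'_iff _).2 fun q _ => (hη q).1,
        (Finset.inf'_le _ hs.choose_spec).trans (hη _).2⟩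
    · intro ε hε z hz t ht
      have hε1 : ε ≤ 1 := hε.2.trans ((Finset.inf'_le _ hs.choose_spec).trans (hη _).2)
      have hεinv : 1 ≤ ε⁻¹ := (one_le_inv₀ hε.1).2 hε1
      have hz0 : t • z.2 ≠ 0 := smul_ne_zero (by linarith) (hKs hz).2
      refine (jb_rpow_mul_norm_dirDs_cexp_le hΩ (hphase ε ⟨hε.1, hε1⟩).1 α β hc hc1
        (A := max 1 B * ε⁻¹ ^ M)
        (one_le_mul_of_one_le_of_one_le (le_max_left _ _) (one_le_pow₀ hεinv))
        (hKs hz).1 (hscale (hcK z hz) ht) fun α' hα' β' hβ' => ?_).trans (le_of_eq ?_)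
      · have hq : (α', β') ∈ s := by simp_all [s]
        refine (hb (α', β') ε ⟨hε.1, hε.2.trans (Finset.inf'_le _ hq)⟩ z.1
          (mem_image_of_mem _ hz) _ hz0).trans ?_
        have h1 : C (α', β') ≤ max 1 B :=
          (hB _ (Finset.mem_image_of_mem _ hq)).trans (le_max_right _ _)
        have h2 := pow_le_pow_right₀ hεinv (hM _ (Finset.mem_image_of_mem N hq))
        rw [zpow_neg, zpow_natCast, ← inv_pow]
        gcongr
      · rw [zpow_neg, zpow_natCast, ← inv_pow, pow_mul, ← mul_pow]
        ring
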